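/- arXiv:math/0307145 — 3 statements merged into one kernel-verified Lean document; each statement's English description precedes it below -/
import Mathlib

section
/- Let P=(A,C) be a measuring α-pairing and (N,ρ_N) a C-rational A-faithful left A-module with induced coaction ϱ_N = (α_N^P)^{-1}∘ρ_N. Then every A-submodule K ⊆ N is again C-rational, ϱ_N(K) ⊆ K⊗_R C, and K is a counital right C-subcomodule of N with coaction ϱ_K = ϱ_N|_K. -/
open TensorProduct

universe u

/-- The canonical map `α^P_M : M ⊗ C → Hom(A, M)` associated to an `R`-pairing
`β : A → C → R`, sending `Σ mᵢ ⊗ cᵢ` to `a ↦ Σ ⟨a, cᵢ⟩ • mᵢ`. -/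
noncomputable def alphaMap (R : Type u) [CommRing R]
    {A : Type u} [AddCommGroup A] [Module R A]
    {C : Type u} [AddCommGroup C] [Module R C]
    (β : A →ₗ[R] C →ₗ[R] R)
    (M : Type u) [AddCommGroup M] [Module R M] :
    (M ⊗[R] C) →ₗ[R] (A →ₗ[R] M) :=
  (dualTensorHom R A M) ∘ₗ
    (TensorProduct.comm R M (Module.Dual R A)).toLinearMap ∘ₗ
    (TensorProduct.map LinearMap.id β.flip)

/-- `(A, C)` is a measuring pairing: `κ_P : A → C*` is multiplicative into the
convolution algebra `C*`. -/
def IsMeasuring (R : Type u) [CommRing R]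
    {A : Type u} [NonUnitalRing A] [Module R A]
    {C : Type u} [AddCommGroup C] [Module R C] [Coalgebra R C]
    (β : A →ₗ[R] C →ₗ[R] R) : Prop :=
  ∀ a b : A,
    β (a * b) =
      (LinearMap.mul' R R) ∘ₗ (TensorProduct.map (β a) (β b)) ∘ₗ
        (Coalgebra.comul (R := R) (A := C))

/-- The rational submodule `Rat^C(M)` of a module with `A`-action `σ`. -/
noncomputable def ratSubmodule (R : Type u) [CommRing R]
    {A : Type u} [AddCommGroup A] [Module R A]
    {C : Type u} [AddCommGroup C] [Module R C]
    (β : A →ₗ[R] C →ₗ[R] R)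
    {M : Type u} [AddCommGroup M] [Module R M]
    (σ : A →ₗ[R] M →ₗ[R] M) : Submodule R M :=
  (LinearMap.range (alphaMap R β M)).comap σ.flip

/-- The `A`-action induced on a right `C`-comodule: `a • m = Σ m₍₀₎⟨a, m₍₁₎⟩`. -/
noncomputable def inducedAction (R : Type u) [CommRing R]
    {A : Type u} [AddCommGroup A] [Module R A]
    {C : Type u} [AddCommGroup C] [Module R C]
    (β : A →ₗ[R] C →ₗ[R] R)
    {M : Type u} [AddCommGroup M] [Module R M]
    (ϱ : M →ₗ[R] M ⊗[R] C) : A →ₗ[R] M →ₗ[R] M :=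
  ((alphaMap R β M) ∘ₗ ϱ).flip

/-- `ϱ : M → M ⊗ C` is a (coassociative, counital) right `C`-comodule structure. -/
def IsRightComodule (R : Type u) [CommRing R]
    {C : Type u} [AddCommGroup C] [Module R C] [Coalgebra R C]
    {M : Type u} [AddCommGroup M] [Module R M]
    (ϱ : M →ₗ[R] M ⊗[R] C) : Prop :=
  ((TensorProduct.assoc R M C C).toLinearMap ∘ₗ (TensorProduct.map ϱ LinearMap.id) ∘ₗ ϱ
      = (TensorProduct.map LinearMap.id (Coalgebra.comul (R := R))) ∘ₗ ϱ)
  ∧ ∀ m : M,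
      (TensorProduct.rid R M)
        ((TensorProduct.map LinearMap.id (Coalgebra.counit (R := R))) (ϱ m)) = m

/-- `ϱ : N → C ⊗ N` is a (coassociative, counital) left `C`-comodule structure. -/
def IsLeftComodule (R : Type u) [CommRing R]
    {C : Type u} [AddCommGroup C] [Module R C] [Coalgebra R C]
    {N : Type u} [AddCommGroup N] [Module R N]
    (ϱ : N →ₗ[R] C ⊗[R] N) : Prop :=
  ((TensorProduct.assoc R C C N).symm.toLinearMap ∘ₗ (TensorProduct.map LinearMap.id ϱ) ∘ₗ ϱ
      = (TensorProduct.map (Coalgebra.comul (R := R)) LinearMap.id) ∘ₗ ϱ)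
  ∧ ∀ n : N,
      (TensorProduct.lid R N)
        ((TensorProduct.map (Coalgebra.counit (R := R)) LinearMap.id) (ϱ n)) = n

/-- The cotensor product `M □_C N` as a submodule of `M ⊗ N`. -/
noncomputable def cotensor (R : Type u) [CommRing R]
    {C : Type u} [AddCommGroup C] [Module R C]
    {M : Type u} [AddCommGroup M] [Module R M]
    {N : Type u} [AddCommGroup N] [Module R N]
    (ϱM : M →ₗ[R] M ⊗[R] C) (ϱN : N →ₗ[R] C ⊗[R] N) : Submodule R (M ⊗[R] N) :=
  LinearMap.ker
    ((TensorProduct.assoc R M C N).toLinearMap ∘ₗ (TensorProduct.map ϱM LinearMap.id)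
      - (TensorProduct.map LinearMap.id ϱN))

/-- The right `A`-action induced on a left `C`-comodule: `n • a = Σ ⟨a, n₍₋₁₎⟩ n₍₀₎`. -/
noncomputable def rAct (R : Type u) [CommRing R]
    {A : Type u} [AddCommGroup A] [Module R A]
    {C : Type u} [AddCommGroup C] [Module R C]
    {N : Type u} [AddCommGroup N] [Module R N]
    (β : A →ₗ[R] C →ₗ[R] R) (ϱ : N →ₗ[R] C ⊗[R] N) (a : A) : N →ₗ[R] N :=
  (TensorProduct.lid R N).toLinearMap ∘ₗ (TensorProduct.map (β a) LinearMap.id) ∘ₗ ϱ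

/-- `Hom_{A-}(B, N)`: the `A`-linear maps `B → N`, where `B` is an `A`-module via `ξ`. -/
noncomputable def homA (R : Type u) [CommRing R]
    {A B N : Type u} [Ring A] [Algebra R A] [Ring B] [Algebra R B]
    [AddCommGroup N] [Module R N]
    (ξ : A →ₐ[R] B) (σN : A →ₗ[R] N →ₗ[R] N) : Submodule R (B →ₗ[R] N) where
  carrier := {f | ∀ (a : A) (b : B), f (ξ a * b) = σN a (f b)}
  zero_mem' := by intro a b; simp
  add_mem' := by intro f g hf hg a b; simp [hf a b, hg a b]
  smul_mem' := by intro r f hf a b; simp [hf a b]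

/-- Evaluation at `1_B` as a linear map on a submodule of `Hom_R(B, N)`. -/
noncomputable def evalAtOne {R B N : Type u} [CommRing R] [Ring B] [Algebra R B]
    [AddCommGroup N] [Module R N] (Hsub : Submodule R (B →ₗ[R] N)) : ↥Hsub →ₗ[R] N where
  toFun f := (f : B →ₗ[R] N) 1
  map_add' f g := by simp
  map_smul' r f := by simp

section AlphaMap

variable {R A C M N : Type u} [CommRing R] [AddCommGroup C] [Module R C]
  [AddCommGroup M] [Module R M] [AddCommGroup N] [Module R N]

section Pairing

variable [AddCommGroup A] [Module R A] (β : A →ₗ[R] C →ₗ[R] R)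

@[simp]
theorem alphaMap_tmul (m : M) (c : C) (a : A) :
    alphaMap R β M (m ⊗ₜ[R] c) a = β a c • m := by
  simp [alphaMap, dualTensorHom_apply]

theorem alphaMap_map (f : M →ₗ[R] N) (x : M ⊗[R] C) (a : A) :
    alphaMap R β N (TensorProduct.map f LinearMap.id x) a = f (alphaMap R β M x a) := by
  induction x with
  | zero => simp
  | tmul m c => simp
  | add x y hx hy => simp [hx, hy]

/-- Under the α-condition, tensoring with `C` preserves injectivity. -/
theorem map_id_injective_of_alphaMap_injective (hα : Function.Injective (alphaMap R β M))
    {f : M →ₗ[R] N} (hf : Function.Injective f) :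
    Function.Injective (TensorProduct.map f (LinearMap.id : C →ₗ[R] C)) := by
  intro x y hxy
  refine hα (LinearMap.ext fun a => hf ?_)
  rw [← alphaMap_map, ← alphaMap_map, hxy]

/-- Under the α-condition for `N ⧸ K`, an element of `N ⊗ C` whose associated map takes values
in `K` comes from `K ⊗ C`. -/
theorem mem_range_map_subtype_of_alphaMap_mem (K : Submodule R N)
    (hα : Function.Injective (alphaMap R β (N ⧸ K))) (x : N ⊗[R] C)
    (hx : ∀ a, alphaMap R β N x a ∈ K) :
    x ∈ LinearMap.range (TensorProduct.map K.subtype (LinearMap.id : C →ₗ[R] C)) := by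
  have hexact : Function.Exact (LinearMap.rTensor C K.subtype) (LinearMap.rTensor C K.mkQ) :=
    rTensor_exact C (LinearMap.exact_subtype_mkQ K) K.mkQ_surjective
  refine (hexact x).mp (hα (LinearMap.ext fun a => ?_))
  rw [LinearMap.rTensor, alphaMap_map]
  simpa using hx a

theorem alphaMap_alphaMap_assoc_symm_tmul (m : M) (y : C ⊗[R] C) (a b : A) :
    alphaMap R β M (alphaMap R β (M ⊗[R] C) ((TensorProduct.assoc R M C C).symm (m ⊗ₜ[R] y)) a) b
      = LinearMap.mul' R R (TensorProduct.map (β b) (β a) y) • m := by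
  induction y with
  | zero => simp
  | tmul c d => simp [smul_smul, mul_comm]
  | add x y hx hy => simp [TensorProduct.tmul_add, add_smul, hx, hy]

end Pairing

variable [NonUnitalRing A] [Module R A] [Coalgebra R C] {β : A →ₗ[R] C →ₗ[R] R}

theorem alphaMap_alphaMap_comul (hmeas : IsMeasuring R β) (x : M ⊗[R] C) (a b : A) :
    alphaMap R β M (alphaMap R β (M ⊗[R] C) ((TensorProduct.assoc R M C C).symm
      (TensorProduct.map LinearMap.id (Coalgebra.comul (R := R)) x)) a) b
      = alphaMap R β M x (b * a) := by
  induction x with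
  | zero => simp
  | tmul m c =>
    rw [TensorProduct.map_tmul, alphaMap_alphaMap_assoc_symm_tmul, alphaMap_tmul, hmeas b a]
    rfl
  | add x y hx hy => simp [hx, hy]

/-- The coaction of a rational module over a measuring α-pairing is coassociative. -/
theorem coassoc_of_alphaMap_comp_eq (hmeas : IsMeasuring R β)
    (hα : ∀ (X : Type u) [AddCommGroup X] [Module R X], Function.Injective (alphaMap R β X))
    {σ : A →ₗ[R] M →ₗ[R] M} (hσ : ∀ a b : A, σ (a * b) = σ a ∘ₗ σ b)
    {ϱ : M →ₗ[R] M ⊗[R] C} (hϱ : alphaMap R β M ∘ₗ ϱ = σ.flip) :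
    (TensorProduct.assoc R M C C).toLinearMap ∘ₗ TensorProduct.map ϱ LinearMap.id ∘ₗ ϱ
      = TensorProduct.map LinearMap.id (Coalgebra.comul (R := R)) ∘ₗ ϱ := by
  have hact (m : M) (a : A) : alphaMap R β M (ϱ m) a = σ a m :=
    LinearMap.congr_fun (LinearMap.congr_fun hϱ m) a
  ext1 m
  refine (TensorProduct.assoc R M C C).symm.injective (hα _ (LinearMap.ext fun a =>
    hα _ (LinearMap.ext fun b => ?_)))
  simp only [LinearMap.comp_apply]
  rw [alphaMap_alphaMap_comul hmeas, LinearEquiv.coe_coe, LinearEquiv.symm_apply_apply,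
    alphaMap_map, hact, hact, hact, hσ, LinearMap.comp_apply]

theorem mul_map_counit_comul (f : C →ₗ[R] R) (c : C) :
    LinearMap.mul' R R (TensorProduct.map f (Coalgebra.counit (R := R))
      (Coalgebra.comul (R := R) c)) = f c := by
  have h : TensorProduct.map f (Coalgebra.counit (R := R) (A := C))
      = TensorProduct.map f LinearMap.id ∘ₗ LinearMap.lTensor C Coalgebra.counit := by
    ext; simp
  rw [h, LinearMap.comp_apply, Coalgebra.lTensor_counit_comul]
  simp

/-- A coassociative coaction inducing a faithful action satisfies the counit law. -/
theorem counit_of_coassoc_of_faithful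
    {σ : A →ₗ[R] M →ₗ[R] M} (hfaithful : Function.Injective σ.flip)
    {ϱ : M →ₗ[R] M ⊗[R] C} (hϱ : alphaMap R β M ∘ₗ ϱ = σ.flip)
    (hcoassoc : (TensorProduct.assoc R M C C).toLinearMap ∘ₗ
        TensorProduct.map ϱ LinearMap.id ∘ₗ ϱ
      = TensorProduct.map LinearMap.id (Coalgebra.comul (R := R)) ∘ₗ ϱ) (m : M) :
    TensorProduct.rid R M
      (TensorProduct.map LinearMap.id (Coalgebra.counit (R := R)) (ϱ m)) = m := by
  have hact (m : M) (a : A) : alphaMap R β M (ϱ m) a = σ a m :=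
    LinearMap.congr_fun (LinearMap.congr_fun hϱ m) a
  refine hfaithful (LinearMap.ext fun a => ?_)
  let contract : M ⊗[R] (C ⊗[R] C) →ₗ[R] M := (TensorProduct.rid R M).toLinearMap ∘ₗ
    TensorProduct.map LinearMap.id
      (LinearMap.mul' R R ∘ₗ TensorProduct.map (β a) (Coalgebra.counit (R := R)))
  have hassoc (y : M ⊗[R] C) (c : C) : contract (TensorProduct.assoc R M C C (y ⊗ₜ[R] c))
      = Coalgebra.counit (R := R) c • alphaMap R β M y a := by
    induction y with
    | zero => simp
    | tmul m d => simp [contract, smul_smul, mul_comm]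
    | add x y hx hy => simp only [TensorProduct.add_tmul, map_add, hx, hy, smul_add,
        LinearMap.add_apply]
  have hcoact (x : M ⊗[R] C) :
      contract (TensorProduct.assoc R M C C (TensorProduct.map ϱ LinearMap.id x))
        = σ a (TensorProduct.rid R M
          (TensorProduct.map LinearMap.id (Coalgebra.counit (R := R)) x)) := by
    induction x with
    | zero => simp
    | tmul m c => simp [hassoc, hact]
    | add x y hx hy => simp only [map_add, hx, hy]
  have hcomul (x : M ⊗[R] C) :
      contract (TensorProduct.map LinearMap.id (Coalgebra.comul (R := R)) x)
        = alphaMap R β M x a := by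
    induction x with
    | zero => simp
    | tmul m c => simp [contract, mul_map_counit_comul]
    | add x y hx hy => simp only [map_add, hx, hy, LinearMap.add_apply]
  have h := congrArg contract (LinearMap.congr_fun hcoassoc m)
  simp only [LinearMap.comp_apply, LinearEquiv.coe_coe] at h
  rw [hcoact, hcomul, hact] at h
  exact h

end AlphaMap

/-- Let `P = (A,C)` be a measuring α-pairing and `(N, σN)` a `C`-rational
`A`-faithful left `A`-module with induced coaction `ϱN` (i.e. `α^P ∘ ϱN = ρ_N`). Then every
`A`-submodule `K ⊆ N` (with the restricted action `σK`) is again `C`-rational,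
`ϱN(K) ⊆ K ⊗ C`, and `K` is a counital right `C`-subcomodule of `N` whose coaction `ϱK`
restricts `ϱN`. -/
theorem submodule_is_subcomodule
    {R A C N : Type u} [CommRing R]
    [NonUnitalRing A] [Module R A] [SMulCommClass R A A] [IsScalarTower R A A]
    [AddCommGroup C] [Module R C] [Coalgebra R C]
    [AddCommGroup N] [Module R N]
    (β : A →ₗ[R] C →ₗ[R] R)
    (hmeas : IsMeasuring R β)
    (hα : ∀ (X : Type u) [AddCommGroup X] [Module R X],
      Function.Injective (alphaMap R β X))
    (σN : A →ₗ[R] N →ₗ[R] N)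
    (hσN : ∀ a b : A, σN (a * b) = (σN a) ∘ₗ (σN b))
    (hNfaithful : Function.Injective σN.flip)
    (ϱN : N →ₗ[R] N ⊗[R] C) (hϱN : (alphaMap R β N) ∘ₗ ϱN = σN.flip)
    (K : Submodule R N) (hK : ∀ a : A, ∀ n ∈ K, σN a n ∈ K)
    (σK : A →ₗ[R] K →ₗ[R] K)
    (hσK : ∀ (a : A) (k : K), ((σK a k : K) : N) = σN a (k : N)) :
    -- `K` is `C`-rational
    (∀ k : K, σK.flip k ∈ LinearMap.range (alphaMap R β K))
    ∧
    -- `ϱN(K) ⊆ K ⊗ C`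
    (∀ k : K, ϱN (k : N)
        ∈ LinearMap.range (TensorProduct.map K.subtype (LinearMap.id : C →ₗ[R] C)))
    ∧
    -- `K` is a counital right `C`-subcomodule with `ϱK = ϱN|_K`
    (∃ ϱK : K →ₗ[R] K ⊗[R] C,
      Function.Injective ϱK
      ∧ ((alphaMap R β K) ∘ₗ ϱK = σK.flip)
      ∧ IsRightComodule R ϱK
      ∧ (∀ k : K, TensorProduct.map K.subtype LinearMap.id (ϱK k) = ϱN (k : N))) := by
  have hact (n : N) (a : A) : alphaMap R β N (ϱN n) a = σN a n :=
    LinearMap.congr_fun (LinearMap.congr_fun hϱN n) a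
  have hrange (k : K) : ϱN (k : N)
      ∈ LinearMap.range (TensorProduct.map K.subtype (LinearMap.id : C →ₗ[R] C)) :=
    mem_range_map_subtype_of_alphaMap_mem β K (hα _) _ fun a => by
      rw [hact]; exact hK a k k.2
  let incl := LinearEquiv.ofInjective (TensorProduct.map K.subtype (LinearMap.id : C →ₗ[R] C))
    (map_id_injective_of_alphaMap_injective β (hα K) K.subtype_injective)
  let ϱK : K →ₗ[R] K ⊗[R] C :=
    incl.symm.toLinearMap ∘ₗ LinearMap.codRestrict _ (ϱN ∘ₗ K.subtype) hrange
  have hrestrict (k : K) : TensorProduct.map K.subtype LinearMap.id (ϱK k) = ϱN (k : N) :=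
    congrArg Subtype.val (incl.apply_symm_apply ⟨ϱN (k : N), hrange k⟩)
  have hϱK : alphaMap R β K ∘ₗ ϱK = σK.flip := by
    refine LinearMap.ext fun k => LinearMap.ext fun a => K.subtype_injective ?_
    rw [LinearMap.comp_apply, ← alphaMap_map, hrestrict, hact]
    exact (hσK a k).symm
  have hσK_mul (a b : A) : σK (a * b) = σK a ∘ₗ σK b := by
    refine LinearMap.ext fun k => Subtype.ext ?_
    simp [hσK, hσN]
  have hKfaithful : Function.Injective σK.flip := by
    intro k l hkl
    refine Subtype.ext (hNfaithful (LinearMap.ext fun a => ?_))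
    simpa [hσK] using congrArg Subtype.val (LinearMap.congr_fun hkl a)
  have hcoassoc := coassoc_of_alphaMap_comp_eq hmeas hα hσK_mul hϱK
  refine ⟨fun k => ⟨ϱK k, LinearMap.congr_fun hϱK k⟩, hrange, ϱK, ?_, hϱK,
    ⟨hcoassoc, counit_of_coassoc_of_faithful hKfaithful hϱK hcoassoc⟩, hrestrict⟩
  refine Function.Injective.of_comp (f := alphaMap R β K) ?_
  rw [← LinearMap.coe_comp, hϱK]
  exact hKfaithful
end

section
/- A measuring R-pairing P=(A,C) (A not necessarily unital) satisfies the α-condition if and only if C is locally projective as an R-module and κ_P(A) ⊆ C* is dense with respect to the finite topology. -/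
open TensorProduct

universe u

@[simp]
lemma alphaMap_tmul_apply {R A C M : Type u} [CommRing R] [AddCommGroup A] [Module R A]
    [AddCommGroup C] [Module R C] [AddCommGroup M] [Module R M]
    (β : A →ₗ[R] C →ₗ[R] R) (m : M) (c : C) (a : A) :
    alphaMap R β M (m ⊗ₜ c) a = β a c • m := by
  simp [alphaMap]

/-- The map `α` of a pairing factors through that of the evaluation pairing. -/
lemma alphaMap_apply_eq_alphaMap_id {R A C M : Type u} [CommRing R] [AddCommGroup A] [Module R A]
    [AddCommGroup C] [Module R C] [AddCommGroup M] [Module R M]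
    (β : A →ₗ[R] C →ₗ[R] R) (t : M ⊗[R] C) (a : A) :
    alphaMap R β M t a =
      alphaMap R (LinearMap.id : Module.Dual R C →ₗ[R] (C →ₗ[R] R)) M t (β a) := by
  induction t with
  | zero => simp
  | tmul m c => simp
  | add x y hx hy => simp [hx, hy]

/-- The functional `α(t)` for the evaluation pairing only sees finitely many elements of `C`. -/
lemma exists_finset_alphaMap_id_congr {R C M : Type u} [CommRing R]
    [AddCommGroup C] [Module R C] [AddCommGroup M] [Module R M] (t : M ⊗[R] C) :
    ∃ s : Finset C, ∀ f g : Module.Dual R C, (∀ c ∈ s, f c = g c) →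
      alphaMap R (LinearMap.id : Module.Dual R C →ₗ[R] (C →ₗ[R] R)) M t f =
        alphaMap R (LinearMap.id : Module.Dual R C →ₗ[R] (C →ₗ[R] R)) M t g := by
  classical
  induction t with
  | zero => exact ⟨∅, by simp⟩
  | tmul m c => exact ⟨{c}, fun f g h => by simp [h c (by simp)]⟩
  | add x y hx hy =>
    obtain ⟨s, hs⟩ := hx
    obtain ⟨s', hs'⟩ := hy
    refine ⟨s ∪ s', fun f g h => ?_⟩
    simp [hs f g fun c hc => h c (by simp [hc]), hs' f g fun c hc => h c (by simp [hc])]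

/-- A pairing satisfying the `α`-condition is dense: test it on the quotient of `R ^ s` by the
restrictions to `s` of the functionals coming from `A`. -/
lemma dense_of_alphaMap_injective {R A C : Type u} [CommRing R] [AddCommGroup A] [Module R A]
    [AddCommGroup C] [Module R C] (β : A →ₗ[R] C →ₗ[R] R)
    (h : ∀ (X : Type u) [AddCommGroup X] [Module R X], Function.Injective (alphaMap R β X))
    (f : C →ₗ[R] R) (s : Finset C) : ∃ a : A, ∀ c ∈ s, β a c = f c := by
  classical
  let restr : (C →ₗ[R] R) →ₗ[R] (s → R) := LinearMap.pi fun c => LinearMap.applyₗ (c : C)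
  let K : Submodule R (s → R) := LinearMap.range (restr ∘ₗ β)
  let t : ((s → R) ⧸ K) ⊗[R] C := ∑ c : s, K.mkQ (Pi.single c 1) ⊗ₜ (c : C)
  have sum_eq (g : C →ₗ[R] R) :
      ∑ c : s, g c • K.mkQ (Pi.single c 1) = K.mkQ (restr g) := by
    rw [pi_eq_sum_univ' (restr g), map_sum]
    refine Finset.sum_congr rfl fun c _ => ?_
    rw [← map_smul]
    congr 1
  have apply_eq {B : Type u} [AddCommGroup B] [Module R B] (γ : B →ₗ[R] C →ₗ[R] R) (b : B) :
      alphaMap R γ _ t b = K.mkQ (restr (γ b)) := by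
    rw [← sum_eq]
    simp only [t, map_sum, LinearMap.sum_apply, alphaMap_tmul_apply]
  have ht : t = 0 := by
    refine h _ (LinearMap.ext fun a => ?_)
    rw [apply_eq, map_zero, LinearMap.zero_apply, Submodule.mkQ_apply,
      Submodule.Quotient.mk_eq_zero]
    exact ⟨a, rfl⟩
  have hf := apply_eq (LinearMap.id : Module.Dual R C →ₗ[R] (C →ₗ[R] R)) f
  rw [ht, map_zero, LinearMap.zero_apply, eq_comm, Submodule.mkQ_apply,
    Submodule.Quotient.mk_eq_zero] at hf
  obtain ⟨a, ha⟩ := hf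
  exact ⟨a, fun c hc => congrFun ha ⟨c, hc⟩⟩

/-- A measuring `R`-pairing `P = (A,C)` (`A` not necessarily unital)
satisfies the α-condition iff `C` is locally projective as an `R`-module and
`κ_P(A) ⊆ C*` is dense with respect to the finite topology. -/
theorem alpha_iff_locProj_and_dense
    {R A C : Type u} [CommRing R]
    [NonUnitalRing A] [Module R A] [SMulCommClass R A A] [IsScalarTower R A A]
    [AddCommGroup C] [Module R C] [Coalgebra R C]
    (β : A →ₗ[R] C →ₗ[R] R)
    (hmeas : IsMeasuring R β) :
    (∀ (X : Type u) [AddCommGroup X] [Module R X],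
        Function.Injective (alphaMap R β X))
    ↔ ((∀ (X : Type u) [AddCommGroup X] [Module R X],
          Function.Injective
            (alphaMap R (LinearMap.id : Module.Dual R C →ₗ[R] (C →ₗ[R] R)) X))
        ∧ (∀ (f : C →ₗ[R] R) (s : Finset C), ∃ a : A, ∀ c ∈ s, β a c = f c)) := by
  refine ⟨fun h => ⟨fun X _ _ x y hxy => h X (LinearMap.ext fun a => ?_),
    dense_of_alphaMap_injective β h⟩, fun ⟨hproj, hdense⟩ X _ _ x y hxy => ?_⟩
  · rw [alphaMap_apply_eq_alphaMap_id, hxy, ← alphaMap_apply_eq_alphaMap_id]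
  · rw [← sub_eq_zero, ← map_sub] at hxy
    rw [← sub_eq_zero]
    refine hproj X (LinearMap.ext fun f => ?_)
    obtain ⟨s, hs⟩ := exists_finset_alphaMap_id_congr (x - y)
    obtain ⟨a, ha⟩ := hdense f s
    rw [← hs _ _ ha, ← alphaMap_apply_eq_alphaMap_id, hxy, map_zero, LinearMap.zero_apply,
      LinearMap.zero_apply]
end

section
/- Let P=(A,C) be a measuring α-pairing. If X is an injective R-module, then X⊗_R C, with coaction id_X⊗Δ_C, is an injective object in the category of counital right C-comodules (equivalently, in the isomorphic category Rat^C(_A M) of C-rational left A-modules). In other words, the functor −⊗_R C: M_R → M^C respects injective objects. -/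
open TensorProduct

universe u

/-- The counit law for `X ⊗ C` with coaction `id_X ⊗ Δ_C`: contracting the middle tensor factor
of `(id_X ⊗ Δ_C) z` with the counit recovers `z`. -/
theorem map_rid_counit_assoc_symm_comul {R C X : Type u} [CommRing R]
    [AddCommGroup C] [Module R C] [Coalgebra R C] [AddCommGroup X] [Module R X] :
    TensorProduct.map ((TensorProduct.rid R X).toLinearMap ∘ₗ
        TensorProduct.map LinearMap.id (Coalgebra.counit (R := R) (A := C)))
        (LinearMap.id : C →ₗ[R] C) ∘ₗ
      (TensorProduct.assoc R X C C).symm.toLinearMap ∘ₗ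
        TensorProduct.map LinearMap.id (Coalgebra.comul (R := R)) = LinearMap.id := by
  have contract (x : X) (t : C ⊗[R] C) :
      TensorProduct.map ((TensorProduct.rid R X).toLinearMap ∘ₗ
          TensorProduct.map LinearMap.id (Coalgebra.counit (R := R) (A := C)))
          (LinearMap.id : C →ₗ[R] C) ((TensorProduct.assoc R X C C).symm (x ⊗ₜ t)) =
        x ⊗ₜ TensorProduct.lid R C ((Coalgebra.counit (R := R) (A := C)).rTensor C t) := by
    induction t with
    | zero => simp
    | add s t hs ht => simp only [tmul_add, map_add, hs, ht]
    | tmul c d => simp [smul_tmul]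
  refine TensorProduct.ext' fun x c => ?_
  simp [contract]

/-- For a comodule `(V, ϱ)` and a linear map `k : V → X`, the map `(k ⊗ id_C) ∘ ϱ` is colinear
for the coaction `id_X ⊗ Δ_C`. -/
theorem IsRightComodule.colinear_map_comp {R C V X : Type u} [CommRing R]
    [AddCommGroup C] [Module R C] [Coalgebra R C] [AddCommGroup V] [Module R V]
    [AddCommGroup X] [Module R X] {ϱ : V →ₗ[R] V ⊗[R] C} (hϱ : IsRightComodule R ϱ)
    (k : V →ₗ[R] X) :
    ((TensorProduct.assoc R X C C).symm.toLinearMap ∘ₗ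
        TensorProduct.map LinearMap.id (Coalgebra.comul (R := R))) ∘ₗ
          (TensorProduct.map k LinearMap.id ∘ₗ ϱ) =
      TensorProduct.map (TensorProduct.map k LinearMap.id ∘ₗ ϱ) LinearMap.id ∘ₗ ϱ := by
  have natural (t : (V ⊗[R] C) ⊗[R] C) :
      (TensorProduct.assoc R X C C).symm (TensorProduct.map k LinearMap.id
          (TensorProduct.assoc R V C C t)) =
        TensorProduct.map (TensorProduct.map k LinearMap.id) LinearMap.id t := by
    rw [LinearEquiv.symm_apply_eq, ← TensorProduct.map_map_assoc, TensorProduct.map_id]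
  ext v
  have coassoc := LinearMap.congr_fun hϱ.1 v
  simp only [LinearMap.comp_apply, LinearEquiv.coe_coe] at coassoc ⊢
  have swap : TensorProduct.map LinearMap.id (Coalgebra.comul (R := R))
      (TensorProduct.map k LinearMap.id (ϱ v)) =
      TensorProduct.map k LinearMap.id
        (TensorProduct.map LinearMap.id (Coalgebra.comul (R := R) (A := C)) (ϱ v)) := by
    simp only [TensorProduct.map_map, LinearMap.id_comp, LinearMap.comp_id]
  rw [swap, ← coassoc, natural]
  simp only [TensorProduct.map_map, LinearMap.id_comp]

/-- Let `P = (A,C)` be a measuring α-pairing. If `X` is an injective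
`R`-module, then `X ⊗ C` with the coaction `id_X ⊗ Δ_C` is an injective object in the
category of counital right `C`-comodules: the functor `− ⊗_R C` respects injectives. -/
theorem tensor_injective_is_injective_comodule
    {R A C X : Type u} [CommRing R]
    [NonUnitalRing A] [Module R A] [SMulCommClass R A A] [IsScalarTower R A A]
    [AddCommGroup C] [Module R C] [Coalgebra R C]
    [AddCommGroup X] [Module R X] [Module.Injective R X]
    (β : A →ₗ[R] C →ₗ[R] R)
    (hmeas : IsMeasuring R β)
    (hα : ∀ (Y : Type u) [AddCommGroup Y] [Module R Y],
      Function.Injective (alphaMap R β Y)) :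
    ∀ (U V : Type u) [AddCommGroup U] [Module R U] [AddCommGroup V] [Module R V],
    ∀ (ϱU : U →ₗ[R] U ⊗[R] C) (ϱV : V →ₗ[R] V ⊗[R] C),
      IsRightComodule R ϱU → Function.Injective ϱU →
      IsRightComodule R ϱV → Function.Injective ϱV →
      ∀ u : U →ₗ[R] V,
        (ϱV ∘ₗ u = (TensorProduct.map u LinearMap.id) ∘ₗ ϱU) →
        Function.Injective u →
        ∀ g : U →ₗ[R] X ⊗[R] C,
          -- `g` is `C`-colinear for the coaction `id_X ⊗ Δ_C` on `X ⊗ C`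
          (((TensorProduct.assoc R X C C).symm.toLinearMap ∘ₗ
              (TensorProduct.map LinearMap.id (Coalgebra.comul (R := R)))) ∘ₗ g
            = (TensorProduct.map g LinearMap.id) ∘ₗ ϱU) →
          ∃ h : V →ₗ[R] X ⊗[R] C,
            (((TensorProduct.assoc R X C C).symm.toLinearMap ∘ₗ
                (TensorProduct.map LinearMap.id (Coalgebra.comul (R := R)))) ∘ₗ h
              = (TensorProduct.map h LinearMap.id) ∘ₗ ϱV)
            ∧ h ∘ₗ u = g := by
  intro U V _ _ _ _ ϱU ϱV _ _ hV _ u hu u_inj g hg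
  obtain ⟨k, hk⟩ := Module.Injective.out u u_inj
    ((TensorProduct.rid R X).toLinearMap ∘ₗ
      TensorProduct.map LinearMap.id (Coalgebra.counit (R := R) (A := C)) ∘ₗ g)
  refine ⟨TensorProduct.map k LinearMap.id ∘ₗ ϱV, hV.colinear_map_comp k, ?_⟩
  have k_comp : k ∘ₗ u = ((TensorProduct.rid R X).toLinearMap ∘ₗ
      TensorProduct.map LinearMap.id (Coalgebra.counit (R := R) (A := C))) ∘ₗ g :=
    LinearMap.ext hk
  calc (TensorProduct.map k LinearMap.id ∘ₗ ϱV) ∘ₗ u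
      = TensorProduct.map (k ∘ₗ u) LinearMap.id ∘ₗ ϱU := by
        rw [LinearMap.comp_assoc, hu, ← LinearMap.comp_assoc, ← TensorProduct.map_comp,
          LinearMap.id_comp]
    _ = TensorProduct.map ((TensorProduct.rid R X).toLinearMap ∘ₗ
          TensorProduct.map LinearMap.id (Coalgebra.counit (R := R) (A := C)))
          LinearMap.id ∘ₗ TensorProduct.map g LinearMap.id ∘ₗ ϱU := by
        rw [k_comp, ← LinearMap.comp_assoc, ← TensorProduct.map_comp, LinearMap.id_comp]
    _ = g := by
        rw [← hg, ← LinearMap.comp_assoc, map_rid_counit_assoc_symm_comul, LinearMap.id_comp]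
end
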